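/- Fix j ∈ {1,…,n} and a subset I ⊆ {1,…,n} with j ∉ I. Then for every η ∈ W = ker V*, writing U_I for the composition of the U_i over i ∈ I (in increasing order of indices; an empty composition is the identity), one has ‖Ṽ_j*(U_I η)‖² = ‖(∏_{i∈I^c∖{j}} V_i*) η‖² − ‖(∏_{i∈I^c} V_i*) η‖², where I^c = {1,…,n} \ I. (Equivalently, as operators on W: (∏_{i∈I} U_i*) P⊥_{W̃_j} (∏_{i∈I} U_i) = (∏_{i∈I^c∖{j}} V_i)(∏_{i∈I^c∖{j}} V_i*)|_W − (∏_{i∈I^c} V_i)(∏_{i∈I^c} V_i*)|_W, using that P⊥_{W̃_j}ξ = Ṽ_j Ṽ_j* ξ for ξ ∈ W.) -/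

import Mathlib

open ContinuousLinearMap Filter Finset

/-- Product of the commuting operators `V i` over a finite index set `s`. -/
noncomputable def opProd {H : Type*} [NormedAddCommGroup H] [InnerProductSpace ℂ H]
    {n : ℕ} (V : Fin n → H →L[ℂ] H) (hcomm : ∀ i j, Commute (V i) (V j))
    (s : Finset (Fin n)) : H →L[ℂ] H :=
  s.noncommProd V fun a _ b _ _ => hcomm a b

/-- The wandering subspace `ker ((∏_{i ∈ s} V i)^*)`. -/
noncomputable def wSub {H : Type*} [NormedAddCommGroup H] [InnerProductSpace ℂ H] [CompleteSpace H]
    {n : ℕ} (V : Fin n → H →L[ℂ] H) (hcomm : ∀ i j, Commute (V i) (V j))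
    (s : Finset (Fin n)) : Submodule ℂ H :=
  LinearMap.ker (ContinuousLinearMap.adjoint (opProd V hcomm s)).toLinearMap

/-- The orthogonal projection of `H` onto `wSub V hcomm s`, as an operator on `H`. -/
noncomputable def wProj {H : Type*} [NormedAddCommGroup H] [InnerProductSpace ℂ H] [CompleteSpace H]
    {n : ℕ} (V : Fin n → H →L[ℂ] H) (hcomm : ∀ i j, Commute (V i) (V j))
    (s : Finset (Fin n)) : H →L[ℂ] H :=
  haveI : CompleteSpace (wSub V hcomm s) :=
    (ContinuousLinearMap.isClosed_ker _).completeSpace_coe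
  (wSub V hcomm s).subtypeL ∘L Submodule.orthogonalProjectionOnto (wSub V hcomm s)

/-- The operator `U_i = P_W ∘ V_i + Ṽ_i^*`, which restricts to a unitary on `W`. -/
noncomputable def Uop {H : Type*} [NormedAddCommGroup H] [InnerProductSpace ℂ H] [CompleteSpace H]
    {n : ℕ} (V : Fin n → H →L[ℂ] H) (hcomm : ∀ i j, Commute (V i) (V j))
    (i : Fin n) : H →L[ℂ] H :=
  (wProj V hcomm Finset.univ) ∘L V i
    + ContinuousLinearMap.adjoint (opProd V hcomm (Finset.univ.erase i))

section WanderingSubspace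

variable {H : Type*} [NormedAddCommGroup H] [InnerProductSpace ℂ H] {n : ℕ}
  (V : Fin n → H →L[ℂ] H) (hcomm : ∀ i j, Commute (V i) (V j))

theorem opProd_singleton (i : Fin n) : opProd V hcomm {i} = V i := by
  simp [opProd]

theorem opProd_empty : opProd V hcomm ∅ = 1 :=
  Finset.noncommProd_empty _ _

theorem opProd_commute (s t : Finset (Fin n)) :
    Commute (opProd V hcomm s) (opProd V hcomm t) :=
  Finset.noncommProd_commute _ _ _ _ fun _ _ =>
    (Finset.noncommProd_commute _ _ _ _ fun _ _ => hcomm _ _).symm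

theorem opProd_union {s t : Finset (Fin n)} (h : Disjoint s t) :
    opProd V hcomm (s ∪ t) = opProd V hcomm s * opProd V hcomm t :=
  Finset.noncommProd_union_of_disjoint h _ _

theorem opProd_apply_sdiff {s t : Finset (Fin n)} (h : s ⊆ t) (x : H) :
    opProd V hcomm t x = opProd V hcomm s (opProd V hcomm (t \ s) x) := by
  conv_lhs => rw [← Finset.union_sdiff_of_subset h, opProd_union V hcomm Finset.disjoint_sdiff]
  rfl

theorem norm_opProd_apply (hiso : ∀ i x, ‖V i x‖ = ‖x‖) (s : Finset (Fin n)) (x : H) :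
    ‖opProd V hcomm s x‖ = ‖x‖ := by
  induction s using Finset.induction_on with
  | empty => simp [opProd_empty]
  | insert a s ha ih =>
    rw [Finset.insert_eq, opProd_union V hcomm (Finset.disjoint_singleton_left.mpr ha),
      opProd_singleton, ContinuousLinearMap.mul_def, ContinuousLinearMap.comp_apply, hiso, ih]

variable [CompleteSpace H]

theorem adjoint_opProd_comm (s t : Finset (Fin n)) (x : H) :
    adjoint (opProd V hcomm s) (adjoint (opProd V hcomm t) x) =
      adjoint (opProd V hcomm t) (adjoint (opProd V hcomm s) x) := by
  have h := congrArg adjoint (opProd_commute V hcomm t s).eq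
  simp only [ContinuousLinearMap.mul_def, adjoint_comp] at h
  exact congrArg (fun T : H →L[ℂ] H => T x) h

theorem adjoint_opProd_apply_sdiff {s t : Finset (Fin n)} (h : s ⊆ t) (x : H) :
    adjoint (opProd V hcomm t) x =
      adjoint (opProd V hcomm (t \ s)) (adjoint (opProd V hcomm s) x) := by
  conv_lhs => rw [← Finset.union_sdiff_of_subset h, opProd_union V hcomm Finset.disjoint_sdiff,
    ContinuousLinearMap.mul_def, adjoint_comp]
  rfl

theorem adjoint_opProd_opProd_self (hiso : ∀ i x, ‖V i x‖ = ‖x‖) (s : Finset (Fin n)) (x : H) :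
    adjoint (opProd V hcomm s) (opProd V hcomm s x) = x :=
  congrArg (fun T : H →L[ℂ] H => T x)
    ((ContinuousLinearMap.norm_map_iff_adjoint_comp_self _).mp (norm_opProd_apply V hcomm hiso s))

theorem adjoint_opProd_opProd_of_subset (hiso : ∀ i x, ‖V i x‖ = ‖x‖) {s t : Finset (Fin n)}
    (h : s ⊆ t) (x : H) :
    adjoint (opProd V hcomm t) (opProd V hcomm s x) = adjoint (opProd V hcomm (t \ s)) x := by
  rw [adjoint_opProd_apply_sdiff V hcomm h, adjoint_opProd_opProd_self V hcomm hiso]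

theorem adjoint_opProd_opProd_of_superset (hiso : ∀ i x, ‖V i x‖ = ‖x‖) {s t : Finset (Fin n)}
    (h : s ⊆ t) (x : H) :
    adjoint (opProd V hcomm s) (opProd V hcomm t x) = opProd V hcomm (t \ s) x := by
  rw [opProd_apply_sdiff V hcomm h, adjoint_opProd_opProd_self V hcomm hiso]

theorem wProj_apply (hiso : ∀ i x, ‖V i x‖ = ‖x‖) (s : Finset (Fin n)) (x : H) :
    wProj V hcomm s x = x - opProd V hcomm s (adjoint (opProd V hcomm s) x) := by
  have : CompleteSpace (wSub V hcomm s) :=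
    (ContinuousLinearMap.isClosed_ker _).completeSpace_coe
  refine Submodule.eq_starProjection_of_mem_of_inner_eq_zero (K := wSub V hcomm s) ?_ ?_
  · simp [wSub, adjoint_opProd_opProd_self V hcomm hiso]
  · intro w hw
    have hw' : adjoint (opProd V hcomm s) w = 0 := hw
    rw [sub_sub_cancel, ← adjoint_inner_right, hw', inner_zero_right]

theorem wProj_opProd_self (hiso : ∀ i x, ‖V i x‖ = ‖x‖) (s : Finset (Fin n)) (x : H) :
    wProj V hcomm s (opProd V hcomm s x) = 0 := by
  rw [wProj_apply V hcomm hiso, adjoint_opProd_opProd_self V hcomm hiso, sub_self]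

theorem adjoint_opProd_erase_adjoint_opProd {i : Fin n} {s : Finset (Fin n)} (hi : i ∈ s) {η : H}
    (hη : η ∈ wSub V hcomm Finset.univ) :
    adjoint (opProd V hcomm (Finset.univ.erase i)) (adjoint (opProd V hcomm s) η) = 0 := by
  have hη' : adjoint (opProd V hcomm Finset.univ) η = 0 := hη
  rw [adjoint_opProd_apply_sdiff V hcomm (Finset.singleton_subset_iff.mpr hi),
    adjoint_opProd_comm V hcomm (Finset.univ.erase i), Finset.erase_eq,
    ← adjoint_opProd_apply_sdiff V hcomm (Finset.subset_univ {i}), hη', map_zero]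

theorem adjoint_opProd_erase_wProj_opProd (hiso : ∀ i x, ‖V i x‖ = ‖x‖) {i : Fin n}
    {s : Finset (Fin n)} (hi : i ∉ s) (x : H) :
    adjoint (opProd V hcomm (Finset.univ.erase i))
        (wProj V hcomm Finset.univ (opProd V hcomm s x)) =
      adjoint (opProd V hcomm (sᶜ.erase i)) x - V i (adjoint (opProd V hcomm sᶜ) x) := by
  have hs : s ⊆ Finset.univ.erase i := by grind
  have h₁ : Finset.univ.erase i \ s = sᶜ.erase i := by ext; simp
  have h₂ : Finset.univ \ Finset.univ.erase i = {i} := by grind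
  rw [wProj_apply V hcomm hiso, map_sub, adjoint_opProd_opProd_of_subset V hcomm hiso hs,
    adjoint_opProd_opProd_of_superset V hcomm hiso (Finset.subset_univ _),
    adjoint_opProd_opProd_of_subset V hcomm hiso (Finset.subset_univ s), h₁, h₂,
    opProd_singleton, Finset.compl_eq_univ_sdiff]

theorem Uop_apply_wProj_add (hiso : ∀ i x, ‖V i x‖ = ‖x‖) {i : Fin n} {s : Finset (Fin n)}
    (hi : i ∉ s) {η : H} (hη : η ∈ wSub V hcomm Finset.univ) :
    Uop V hcomm i (wProj V hcomm Finset.univ (opProd V hcomm s η) +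
        adjoint (opProd V hcomm sᶜ) η) =
      wProj V hcomm Finset.univ (opProd V hcomm (insert i s) η) +
        adjoint (opProd V hcomm (insert i s)ᶜ) η := by
  have hV (y : H) : V i (opProd V hcomm Finset.univ y) = opProd V hcomm Finset.univ (V i y) := by
    rw [← opProd_singleton V hcomm i]
    exact congrArg (fun T : H →L[ℂ] H => T y) (opProd_commute V hcomm {i} Finset.univ).eq
  have h₁ : wProj V hcomm Finset.univ (V i (wProj V hcomm Finset.univ (opProd V hcomm s η))) =
      wProj V hcomm Finset.univ (opProd V hcomm (insert i s) η) := by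
    rw [wProj_apply V hcomm hiso _ (opProd V hcomm s η), map_sub, map_sub, hV,
      wProj_opProd_self V hcomm hiso, sub_zero, Finset.insert_eq,
      opProd_union V hcomm (Finset.disjoint_singleton_left.mpr hi), opProd_singleton]
    rfl
  have h₂ : wProj V hcomm Finset.univ (V i (adjoint (opProd V hcomm sᶜ) η)) =
      V i (adjoint (opProd V hcomm sᶜ) η) := by
    rw [wProj_apply V hcomm hiso, ← opProd_singleton V hcomm i,
      adjoint_opProd_opProd_of_subset V hcomm hiso (Finset.subset_univ _), ← Finset.erase_eq,
      adjoint_opProd_erase_adjoint_opProd V hcomm (Finset.mem_compl.mpr hi) hη, map_zero, sub_zero]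
  simp only [Uop, add_apply, ContinuousLinearMap.comp_apply, map_add]
  rw [h₁, h₂, adjoint_opProd_erase_wProj_opProd V hcomm hiso hi,
    adjoint_opProd_erase_adjoint_opProd V hcomm (Finset.mem_compl.mpr hi) hη,
    Finset.compl_insert]
  abel

theorem prod_map_Uop_apply (hiso : ∀ i x, ‖V i x‖ = ‖x‖) {l : List (Fin n)} (hl : l.Nodup)
    {η : H} (hη : η ∈ wSub V hcomm Finset.univ) :
    (l.map (Uop V hcomm)).prod η =
      wProj V hcomm Finset.univ (opProd V hcomm l.toFinset η) +
        adjoint (opProd V hcomm l.toFinsetᶜ) η := by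
  induction l with
  | nil =>
    have hη' : adjoint (opProd V hcomm Finset.univ) η = 0 := hη
    simp [wProj_apply V hcomm hiso, opProd_empty, hη']
  | cons i l ih =>
    rw [List.nodup_cons] at hl
    rw [List.map_cons, List.prod_cons, ContinuousLinearMap.mul_def, ContinuousLinearMap.comp_apply, ih hl.2,
      Uop_apply_wProj_add V hcomm hiso (by simpa using hl.1) hη, List.toFinset_cons]

end WanderingSubspace

theorem norm_sub_apply_adjoint_sq {H : Type*} [NormedAddCommGroup H] [InnerProductSpace ℂ H]
    [CompleteSpace H] (T : H →L[ℂ] H) (hT : ∀ x, ‖T x‖ = ‖x‖) (x : H) :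
    ‖x - T (adjoint T x)‖ ^ 2 = ‖x‖ ^ 2 - ‖adjoint T x‖ ^ 2 := by
  rw [@norm_sub_sq ℂ, ← adjoint_inner_left, inner_self_eq_norm_sq, hT]
  ring

/-- For `j ∉ I` and `η ∈ W`, writing `U_I` for the composition of the `U_i` over `i ∈ I`
(in increasing order of indices), one has
`‖Ṽ_j^*(U_I η)‖² = ‖(∏_{i∈I^c∖{j}} V_i^*) η‖² − ‖(∏_{i∈I^c} V_i^*) η‖²`. -/
theorem stmt7 {H : Type*} [NormedAddCommGroup H] [InnerProductSpace ℂ H] [CompleteSpace H]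
    {n : ℕ} (hn : 2 ≤ n) (V : Fin n → H →L[ℂ] H)
    (hiso : ∀ i x, ‖V i x‖ = ‖x‖) (hcomm : ∀ i j, Commute (V i) (V j))
    (hshift : ∀ x : H,
      Tendsto (fun m : ℕ => ((ContinuousLinearMap.adjoint (opProd V hcomm Finset.univ)) ^ m) x)
        atTop (nhds 0))
    (j : Fin n) (I : Finset (Fin n)) (hj : j ∉ I)
    (η : H) (hη : η ∈ wSub V hcomm Finset.univ) :
    ‖ContinuousLinearMap.adjoint (opProd V hcomm (Finset.univ.erase j))
        (((I.sort (· ≤ ·)).map (Uop V hcomm)).prod η)‖ ^ 2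
      = ‖ContinuousLinearMap.adjoint (opProd V hcomm (Iᶜ.erase j)) η‖ ^ 2
        - ‖ContinuousLinearMap.adjoint (opProd V hcomm Iᶜ) η‖ ^ 2 := by
  rw [prod_map_Uop_apply V hcomm hiso (Finset.sort_nodup I (· ≤ ·)) hη, Finset.sort_toFinset,
    map_add, adjoint_opProd_erase_wProj_opProd V hcomm hiso hj,
    adjoint_opProd_erase_adjoint_opProd V hcomm (Finset.mem_compl.mpr hj) hη, add_zero]
  have h : adjoint (opProd V hcomm Iᶜ) η =
      adjoint (V j) (adjoint (opProd V hcomm (Iᶜ.erase j)) η) := by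
    rw [adjoint_opProd_apply_sdiff V hcomm (Finset.singleton_subset_iff.mpr
      (Finset.mem_compl.mpr hj)), adjoint_opProd_comm, opProd_singleton, Finset.erase_eq]
  rw [h, norm_sub_apply_adjoint_sq (V j) (hiso j)]
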